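/- Let p ≥ 1, let I (boldface) denote the pm-by-pm identity (block diagonal with I_m blocks), let E = (I_m, …, I_m) be the m-by-pm block row matrix, and let L be the pm-by-pm block lower triangular matrix whose (i,j) block is I_m for j ≤ i and 0 for j > i. Then L^T + L = I + E^T E, and the (p+1)m-square block matrix [[I + E^T E, E^T], [E, 2I_m]] (which equals Q_PD^T + Q_PD for Q_PD = [[L, E^T],[0, I_m]]) is symmetric positive definite. -/

import Mathlib

open Matrix

/-- The matrix `1 + FᵀF` has a strictly positive quadratic form, for every real matrix `F`. -/
lemma dotProduct_one_add_transpose_mul_self_mulVec_pos {m n : Type*} [Fintype m] [Fintype n]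
    [DecidableEq n] (F : Matrix m n ℝ) {x : n → ℝ} (hx : x ≠ 0) :
    0 < x ⬝ᵥ ((1 + Fᵀ * F) *ᵥ x) := by
  have hquad : x ⬝ᵥ ((1 + Fᵀ * F) *ᵥ x) = x ⬝ᵥ x + (F *ᵥ x) ⬝ᵥ (F *ᵥ x) := by
    rw [add_mulVec, one_mulVec, dotProduct_add, ← mulVec_mulVec, dotProduct_mulVec,
      vecMul_transpose]
  have hxx : 0 < x ⬝ᵥ x := by simpa using dotProduct_star_self_pos_iff.mpr hx
  have hF : 0 ≤ (F *ᵥ x) ⬝ᵥ (F *ᵥ x) := by simpa using dotProduct_star_self_nonneg (F *ᵥ x)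
  rw [hquad]
  exact add_pos_of_pos_of_nonneg hxx hF

/-- The block matrix `[[1 + EᵀE, Eᵀ], [E, 2]]` is `1 + FᵀF` for the block row `F = (E, 1)`. -/
lemma fromBlocks_eq_one_add_transpose_mul_fromCols {m n : Type*} [Fintype m]
    [DecidableEq m] [DecidableEq n] (E : Matrix m n ℝ) :
    fromBlocks (1 + Eᵀ * E) Eᵀ E ((2 : ℝ) • 1) =
      1 + (fromCols E (1 : Matrix m m ℝ))ᵀ * fromCols E (1 : Matrix m m ℝ) := by
  rw [transpose_fromCols, fromRows_mul_fromCols, ← fromBlocks_one, fromBlocks_add]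
  simp [two_smul]

/-- With `L` the block lower-triangular all-identity matrix and
`E = (I_m, …, I_m)`: `Lᵀ + L = I + EᵀE`, and the block matrix
`[[I + EᵀE, Eᵀ], [E, 2I_m]]` (which equals `Q_PDᵀ + Q_PD` for
`Q_PD = [[L, Eᵀ], [0, I_m]]`) is symmetric positive definite. -/
theorem stmt17 (p m : ℕ) (hp : 1 ≤ p)
    (L : Matrix (Fin p × Fin m) (Fin p × Fin m) ℝ)
    (E : Matrix (Fin m) (Fin p × Fin m) ℝ)
    (hL : ∀ (i j : Fin p) (a c : Fin m),
      L (i, a) (j, c) = if j ≤ i then (1 : Matrix (Fin m) (Fin m) ℝ) a c else 0)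
    (hE : ∀ (a : Fin m) (j : Fin p) (c : Fin m),
      E a (j, c) = (1 : Matrix (Fin m) (Fin m) ℝ) a c) :
    Lᵀ + L = 1 + Eᵀ * E
    ∧ (Matrix.fromBlocks (1 + Eᵀ * E) Eᵀ E ((2 : ℝ) • 1) :
          Matrix ((Fin p × Fin m) ⊕ Fin m) ((Fin p × Fin m) ⊕ Fin m) ℝ)
        = (Matrix.fromBlocks L Eᵀ 0 1)ᵀ + Matrix.fromBlocks L Eᵀ 0 1
    ∧ (Matrix.fromBlocks (1 + Eᵀ * E) Eᵀ E ((2 : ℝ) • 1) :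
          Matrix ((Fin p × Fin m) ⊕ Fin m) ((Fin p × Fin m) ⊕ Fin m) ℝ)ᵀ
        = Matrix.fromBlocks (1 + Eᵀ * E) Eᵀ E ((2 : ℝ) • 1)
    ∧ ∀ x : (Fin p × Fin m) ⊕ Fin m → ℝ, x ≠ 0 →
        0 < x ⬝ᵥ ((Matrix.fromBlocks (1 + Eᵀ * E) Eᵀ E ((2 : ℝ) • 1) :
          Matrix ((Fin p × Fin m) ⊕ Fin m) ((Fin p × Fin m) ⊕ Fin m) ℝ) *ᵥ x) := by
  have hLE : Lᵀ + L = 1 + Eᵀ * E := by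
    ext ⟨i, a⟩ ⟨j, c⟩
    have hEE : (Eᵀ * E) (i, a) (j, c) = (1 : Matrix (Fin m) (Fin m) ℝ) a c := by
      simp [mul_apply, hE, one_apply, eq_comm]
    rw [Matrix.add_apply, Matrix.add_apply, hEE, transpose_apply, hL, hL]
    rcases lt_trichotomy i j with h | rfl | h
    · simp [one_apply, h.le, h.not_ge, h.ne, eq_comm]
    · simp [one_apply, eq_comm]
    · simp [one_apply, h.le, h.not_ge, h.ne']
  refine ⟨hLE, ?_, ?_, fun x hx => ?_⟩
  · rw [fromBlocks_transpose, fromBlocks_add, hLE]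
    simp [two_smul]
  · simp [fromBlocks_transpose]
  · rw [fromBlocks_eq_one_add_transpose_mul_fromCols]
    exact dotProduct_one_add_transpose_mul_self_mulVec_pos _ hx
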